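/- arXiv:2102.00361 — 9 statements merged into one kernel-verified Lean document; each statement's English description precedes it below -/
import Mathlib

section
/- Let (E,ρ) be a metric space, let μ and ν be Borel probability measures on E, and suppose ν is supported on a finite set D ⊆ E of cardinality N ≥ 1. Let ψ : [0,∞) → [0,∞) be a function such that μ(B(x,r)) ≤ ψ(r) for every x ∈ E and r ≥ 0. Then for every coupling π of ν and μ, every p > 0, and every r ≥ 0 satisfying ψ(r) ≤ 1/(2N), one has ∫_{E×E} ρ(x,y)^p π(dx,dy) ≥ r^p/2. In particular, the L^p-Wasserstein distance satisfies W_p(ν,μ) ≥ 2^{−1/p} r for every such r. -/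
open MeasureTheory Metric ENNReal

/-- The union of `D.card` balls of `μ`-mass at most `c` has mass at most `1/2`
as soon as `c ≤ 1 / (2 * D.card)`. -/
theorem measure_biUnion_ball_le_half {E : Type*} [MetricSpace E] [MeasurableSpace E]
    (μ : Measure E) (D : Finset E) (hD : 1 ≤ D.card) {r c : ℝ}
    (hμ : ∀ x, μ (ball x r) ≤ ENNReal.ofReal c) (hc : c ≤ 1 / (2 * D.card)) :
    μ (⋃ x ∈ D, ball x r) ≤ 2⁻¹ := by
  have hD' : (0 : ℝ) < D.card := by exact_mod_cast hD
  calc μ (⋃ x ∈ D, ball x r) ≤ ∑ x ∈ D, μ (ball x r) := measure_biUnion_finset_le _ _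
    _ ≤ ∑ _x ∈ D, ENNReal.ofReal (1 / (2 * D.card)) :=
        Finset.sum_le_sum fun x _ => (hμ x).trans (ENNReal.ofReal_le_ofReal hc)
    _ = ENNReal.ofReal (D.card * (1 / (2 * D.card))) := by
        rw [Finset.sum_const, nsmul_eq_mul, ENNReal.ofReal_mul hD'.le, ENNReal.ofReal_natCast]
    _ = 2⁻¹ := by
        rw [show (D.card : ℝ) * (1 / (2 * D.card)) = 2⁻¹ by field_simp,
          ENNReal.ofReal_inv_of_pos two_pos, ENNReal.ofReal_ofNat]

/-- If the first marginal of `π` is carried by a finite set `D` and the second marginal gives mass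
at most `1/2` to the `r`-neighbourhood of `D`, then `π` has transport cost at least `r ^ p / 2`. -/
theorem ofReal_rpow_div_two_le_lintegral_dist {E : Type*} [MetricSpace E] [MeasurableSpace E]
    [BorelSpace E] (π : Measure (E × E)) [IsProbabilityMeasure π] (D : Finset E) {p r : ℝ}
    (hp : 0 < p) (hr : 0 ≤ r) (hfst : π.map Prod.fst ((D : Set E)ᶜ) = 0)
    (hsnd : π.map Prod.snd (⋃ x ∈ D, ball x r) ≤ 2⁻¹) :
    ENNReal.ofReal (r ^ p / 2) ≤ ∫⁻ z, ENNReal.ofReal (dist z.1 z.2 ^ p) ∂π := by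
  have hDm : MeasurableSet ((D : Set E)ᶜ) := D.measurableSet.compl
  have hUm : MeasurableSet (⋃ x ∈ D, ball x r) :=
    D.measurableSet_biUnion fun x _ => measurableSet_ball
  rw [Measure.map_apply measurable_fst hDm] at hfst
  rw [Measure.map_apply measurable_snd hUm] at hsnd
  set T : Set (E × E) := Prod.fst ⁻¹' (D : Set E)ᶜ ∪ Prod.snd ⁻¹' ⋃ x ∈ D, ball x r with hT
  have hTm : MeasurableSet T := (measurable_fst hDm).union (measurable_snd hUm)
  have hTle : π T ≤ 2⁻¹ := (measure_union_le _ _).trans (by rwa [hfst, zero_add])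
  have hTc : 2⁻¹ ≤ π Tᶜ := by
    rw [prob_compl_eq_one_sub hTm, ← ENNReal.one_sub_inv_two]
    exact tsub_le_tsub_left hTle 1
  calc ENNReal.ofReal (r ^ p / 2) = ENNReal.ofReal (r ^ p) * 2⁻¹ := by
        rw [ENNReal.ofReal_div_of_pos two_pos, ENNReal.ofReal_ofNat, div_eq_mul_inv]
    _ ≤ ENNReal.ofReal (r ^ p) * π Tᶜ := by gcongr
    _ = ∫⁻ _z in Tᶜ, ENNReal.ofReal (r ^ p) ∂π := (setLIntegral_const _ _).symm
    _ ≤ ∫⁻ z in Tᶜ, ENNReal.ofReal (dist z.1 z.2 ^ p) ∂π := by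
        refine setLIntegral_mono' hTm.compl fun z hz => ENNReal.ofReal_le_ofReal ?_
        refine Real.rpow_le_rpow hr ?_ hp.le
        simp only [hT, Set.mem_compl_iff, Set.mem_union, Set.mem_preimage, Set.mem_iUnion,
          mem_ball, not_or, not_not, not_exists, not_lt, SetLike.mem_coe] at hz
        rw [dist_comm]
        exact hz.2 z.1 hz.1
    _ ≤ ∫⁻ z, ENNReal.ofReal (dist z.1 z.2 ^ p) ∂π := setLIntegral_le_lintegral _ _

/-- If `μ(B(x,r)) ≤ ψ(r)`, `ν` is supported on `N ≥ 1` points and `ψ(r) ≤ 1/(2N)`,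
then every coupling `π` of `ν` and `μ` satisfies `∫ ρ^p dπ ≥ r^p/2`; consequently
the `L^p`-Wasserstein distance satisfies `W_p(ν,μ) ≥ 2^{-1/p} r`. -/
theorem stmt_1
    {E : Type*} [MetricSpace E] [MeasurableSpace E] [BorelSpace E]
    (μ ν : Measure E) [IsProbabilityMeasure μ] [IsProbabilityMeasure ν]
    (D : Finset E) (N : ℕ) (hN : 1 ≤ N) (hDcard : D.card = N)
    (hν : ν ((D : Set E)ᶜ) = 0)
    (ψ : ℝ → ℝ)
    (hψ : ∀ x : E, ∀ r : ℝ, 0 ≤ r → μ (ball x r) ≤ ENNReal.ofReal (ψ r))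
    (p : ℝ) (hp : 0 < p) (r : ℝ) (hr : 0 ≤ r) (hrψ : ψ r ≤ 1 / (2 * N)) :
    (∀ π : Measure (E × E), IsProbabilityMeasure π →
        π.map Prod.fst = ν → π.map Prod.snd = μ →
        ENNReal.ofReal (r ^ p / 2) ≤ ∫⁻ z, ENNReal.ofReal (dist z.1 z.2 ^ p) ∂π) ∧
      ENNReal.ofReal ((2 : ℝ) ^ (-1 / p) * r) ≤
        sInf { w : ℝ≥0∞ | ∃ π : Measure (E × E), IsProbabilityMeasure π ∧
          π.map Prod.fst = ν ∧ π.map Prod.snd = μ ∧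
          w = (∫⁻ z, ENNReal.ofReal (dist z.1 z.2 ^ p) ∂π) ^ (1 / p) } := by
  have hcost : ∀ π : Measure (E × E), IsProbabilityMeasure π →
      π.map Prod.fst = ν → π.map Prod.snd = μ →
      ENNReal.ofReal (r ^ p / 2) ≤ ∫⁻ z, ENNReal.ofReal (dist z.1 z.2 ^ p) ∂π := by
    rintro π _ rfl rfl
    subst hDcard
    exact ofReal_rpow_div_two_le_lintegral_dist π D hp hr hν
      (measure_biUnion_ball_le_half _ D hN (fun x => hψ x r hr) hrψ)
  refine ⟨hcost, le_sInf ?_⟩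
  rintro w ⟨π, hπ, hfst, hsnd, rfl⟩
  have hroot : (2 : ℝ) ^ (-1 / p) * r = (r ^ p / 2) ^ (1 / p) := by
    rw [Real.div_rpow (Real.rpow_nonneg hr p) two_pos.le, ← Real.rpow_mul hr,
      mul_one_div_cancel hp.ne', Real.rpow_one, neg_div, Real.rpow_neg two_pos.le]
    ring
  rw [hroot, ← ENNReal.ofReal_rpow_of_nonneg (by positivity) (by positivity)]
  exact ENNReal.rpow_le_rpow (hcost π hπ hfst hsnd) (by positivity)
end

section
/- Let λ > 0, b > 0 and ε ∈ (0,b) satisfy b² − 4λε − ε² > 0. Then ∫_ℝ exp(−(b−ε)x²/2) · ( ∫_ℝ exp(−λ(x−y)² − (b+ε)y²/2) dy )^{−1} dx = (2λ + b + ε) / √(b² − 4λε − ε²). -/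
open MeasureTheory Real

/-- Gaussian integral of `exp (-l (x - y)² - c y² / 2)` in `y`, by completing the square. -/
theorem integral_exp_neg_sq_sub_sq (l c x : ℝ) (h : 0 < 2 * l + c) :
    ∫ y : ℝ, Real.exp (-l * (x - y) ^ 2 - c * y ^ 2 / 2) =
      Real.exp (-(l * c / (2 * l + c)) * x ^ 2) * √(π / ((2 * l + c) / 2)) := by
  rw [← integral_gaussian ((2 * l + c) / 2),
    ← integral_sub_right_eq_self (fun y : ℝ => Real.exp (-((2 * l + c) / 2) * y ^ 2))
      (2 * l * x / (2 * l + c)),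
    ← integral_const_mul]
  congr 1
  ext y
  rw [← Real.exp_add]
  congr 1
  obtain ⟨s, rfl⟩ : ∃ s, c = s - 2 * l := ⟨2 * l + c, by ring⟩
  rw [add_sub_cancel] at h ⊢
  field_simp
  ring

/-- `∫ exp(-(b-ε)x²/2) (∫ exp(-λ(x-y)² - (b+ε)y²/2) dy)⁻¹ dx
      = (2λ+b+ε)/√(b²-4λε-ε²)`. -/
theorem stmt_3 (l b ε : ℝ) (hl : 0 < l) (hb : 0 < b) (hε : 0 < ε) (hεb : ε < b)
    (hpos : 0 < b ^ 2 - 4 * l * ε - ε ^ 2) :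
    ∫ x : ℝ, Real.exp (-(b - ε) * x ^ 2 / 2) *
        (∫ y : ℝ, Real.exp (-l * (x - y) ^ 2 - (b + ε) * y ^ 2 / 2))⁻¹ =
      (2 * l + b + ε) / Real.sqrt (b ^ 2 - 4 * l * ε - ε ^ 2) := by
  have hS : 0 < 2 * l + (b + ε) := by positivity
  have key (x : ℝ) : Real.exp (-(b - ε) * x ^ 2 / 2) *
      (∫ y : ℝ, Real.exp (-l * (x - y) ^ 2 - (b + ε) * y ^ 2 / 2))⁻¹ =
      Real.exp (-((b ^ 2 - 4 * l * ε - ε ^ 2) / (2 * (2 * l + (b + ε)))) * x ^ 2) *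
        (√(π / ((2 * l + (b + ε)) / 2)))⁻¹ := by
    rw [integral_exp_neg_sq_sub_sq l (b + ε) x hS, mul_inv, ← Real.exp_neg, ← mul_assoc,
      ← Real.exp_add]
    congr 2
    field_simp
    ring
  simp_rw [key]
  rw [integral_mul_const, integral_gaussian, ← div_eq_mul_inv, ← Real.sqrt_div (by positivity),
    add_assoc]
  nth_rewrite 3 [← Real.sqrt_sq hS.le]
  rw [← Real.sqrt_div (sq_nonneg _)]
  congr 1
  field_simp
end

section
/- Let p > 1, c₀ > 0 and let (λ_n)_{n≥1} be positive real numbers with λ_n ≥ c₀ n^p for all n ≥ 1. Then there exists a constant C > 0 such that for every ε ∈ (0,1], ∑_{n=1}^∞ (1 − e^{−2ελ_n})/λ_n ≤ C ε^{1 − 1/p}. -/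
open Real

/-- Comparison of a tail of the `p`-series with the integral of `x ^ (-p)`. -/
theorem sum_range_rpow_neg_le {p : ℝ} (hp : 1 < p) {a : ℝ} (ha : 0 < a) (m : ℕ) :
    ∑ i ∈ Finset.range m, (a + ((i + 1 : ℕ) : ℝ)) ^ (-p) ≤ a ^ (1 - p) / (p - 1) := by
  have hanti : AntitoneOn (fun x : ℝ => x ^ (-p)) (Set.Icc a (a + m)) := fun x hx y _ hxy =>
    Real.rpow_le_rpow_of_nonpos (ha.trans_le hx.1) hxy (by linarith)
  have hle : a ≤ a + m := le_add_of_nonneg_right m.cast_nonneg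
  have h0 : (0 : ℝ) ∉ Set.uIcc a (a + m) := by
    rw [Set.uIcc_of_le hle]
    exact fun h => ha.not_ge h.1
  refine hanti.sum_le_integral.trans ?_
  rw [integral_rpow (Or.inr ⟨by linarith, h0⟩),
    show (-p + 1 : ℝ) = -(p - 1) by ring, div_neg, ← neg_div, show 1 - p = -(p - 1) by ring]
  have hp' : 0 < p - 1 := by linarith
  gcongr
  have : 0 ≤ (a + m) ^ (-(p - 1)) := Real.rpow_nonneg (ha.le.trans hle) _
  linarith

/-- If `λ_n ≥ c₀ n^p > 0` with `p > 1`, then `∑_{n≥1} (1-e^{-2ελ_n})/λ_n ≤ C ε^{1-1/p}`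
for all `ε ∈ (0,1]`. -/
theorem stmt_5 (p c₀ : ℝ) (hp : 1 < p) (hc₀ : 0 < c₀) (lam : ℕ → ℝ)
    (hpos : ∀ n : ℕ, 1 ≤ n → 0 < lam n)
    (hlam : ∀ n : ℕ, 1 ≤ n → c₀ * (n : ℝ) ^ p ≤ lam n) :
    ∃ C : ℝ, 0 < C ∧ ∀ ε : ℝ, 0 < ε → ε ≤ 1 →
      ∑' n : ℕ, (1 - Real.exp (-2 * ε * lam (n + 1))) / lam (n + 1) ≤
        C * ε ^ (1 - 1 / p) := by
  have hp0 : 0 < p := by linarith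
  have hp' : 0 < p - 1 := by linarith
  refine ⟨4 + c₀⁻¹ * (1 / (p - 1)), by positivity, fun ε hε hε1 => ?_⟩
  set f : ℕ → ℝ := fun n => (1 - Real.exp (-2 * ε * lam (n + 1))) / lam (n + 1)
  have hl : ∀ n : ℕ, 0 < lam (n + 1) := fun n => hpos _ n.succ_pos
  have hf0 : ∀ n, 0 ≤ f n := fun n => by
    refine div_nonneg (sub_nonneg.2 (Real.exp_le_one_iff.2 ?_)) (hl n).le
    nlinarith [mul_pos hε (hl n)]
  have hf_le : ∀ n, f n ≤ 2 * ε := fun n => by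
    rw [div_le_iff₀ (hl n)]
    linarith [Real.add_one_le_exp (-2 * ε * lam (n + 1))]
  have hf_tail : ∀ n : ℕ, f n ≤ c₀⁻¹ * ((n + 1 : ℕ) : ℝ) ^ (-p) := fun n => by
    rw [Real.rpow_neg (Nat.cast_nonneg _), ← mul_inv, ← one_div]
    have hn : (0 : ℝ) < ((n + 1 : ℕ) : ℝ) := Nat.cast_pos.2 n.succ_pos
    exact div_le_div₀ zero_le_one (by linarith [Real.exp_pos (-2 * ε * lam (n + 1))])
      (by positivity) (hlam _ n.succ_pos)
  set x : ℝ := ε ^ (-(1 / p))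
  have hx1 : 1 ≤ x :=
    Real.one_le_rpow_of_pos_of_le_one_of_nonpos hε hε1 (by simp [hp0.le])
  have hxε : ε * x = ε ^ (1 - 1 / p) := by
    rw [sub_eq_add_neg, Real.rpow_add hε, Real.rpow_one]
  have hxp : x ^ (1 - p) = ε ^ (1 - 1 / p) := by
    rw [← Real.rpow_mul hε.le]
    congr 1
    field_simp
    ring
  set N := ⌈x⌉₊
  have hxN : x ≤ N := Nat.le_ceil x
  have hNx : (N : ℝ) ≤ 2 * x := by linarith [Nat.ceil_lt_add_one (zero_le_one.trans hx1)]
  have hN0 : (0 : ℝ) < N := by linarith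
  have hhead : ∑ n ∈ Finset.range N, f n ≤ 4 * ε ^ (1 - 1 / p) := by
    calc ∑ n ∈ Finset.range N, f n ≤ ∑ _n ∈ Finset.range N, 2 * ε :=
          Finset.sum_le_sum fun n _ => hf_le n
      _ = N * (2 * ε) := by simp
      _ ≤ 2 * x * (2 * ε) := by gcongr
      _ = 4 * ε ^ (1 - 1 / p) := by rw [← hxε]; ring
  refine Real.tsum_le_of_sum_range_le hf0 fun m => ?_
  have htail : ∑ i ∈ Finset.range m, f (N + i) ≤
      c₀⁻¹ * (1 / (p - 1)) * ε ^ (1 - 1 / p) := by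
    calc ∑ i ∈ Finset.range m, f (N + i)
        ≤ ∑ i ∈ Finset.range m, c₀⁻¹ * ((N : ℝ) + ((i + 1 : ℕ) : ℝ)) ^ (-p) :=
          Finset.sum_le_sum fun i _ => by
            simpa only [add_assoc, Nat.cast_add] using hf_tail (N + i)
      _ ≤ c₀⁻¹ * ((N : ℝ) ^ (1 - p) / (p - 1)) := by
          rw [← Finset.mul_sum]
          gcongr
          exact sum_range_rpow_neg_le hp hN0 m
      _ ≤ c₀⁻¹ * (x ^ (1 - p) / (p - 1)) := by
          have := Real.rpow_le_rpow_of_nonpos (by linarith) hxN (by linarith : 1 - p ≤ 0)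
          gcongr
      _ = c₀⁻¹ * (1 / (p - 1)) * ε ^ (1 - 1 / p) := by rw [hxp]; ring
  calc ∑ n ∈ Finset.range m, f n ≤ ∑ n ∈ Finset.range (N + m), f n :=
        Finset.sum_le_sum_of_subset_of_nonneg (Finset.range_mono (Nat.le_add_left m N))
          fun n _ _ => hf0 n
    _ = ∑ n ∈ Finset.range N, f n + ∑ i ∈ Finset.range m, f (N + i) :=
        Finset.sum_range_add f N m
    _ ≤ (4 + c₀⁻¹ * (1 / (p - 1))) * ε ^ (1 - 1 / p) := by linarith
end

section
/- Let p > 0, c > 0 and let (λ_n)_{n≥1} be real numbers with λ_n ≥ c·exp(c n^p) for all n ≥ 1. Then there exists a constant C > 0 such that for every ε ∈ (0,1], ∑_{n=1}^∞ e^{−2ελ_n} ≤ C (log(1 + ε^{−1}))^{1/p}. -/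
open Real

/-- A double exponential `exp (-a exp (b n ^ p))` is summable. -/
theorem summable_exp_neg_mul_exp_rpow {a b p : ℝ} (ha : 0 < a) (hb : 0 < b) (hp : 0 < p) :
    Summable fun n : ℕ => Real.exp (-(a * Real.exp (b * (n : ℝ) ^ p))) := by
  obtain ⟨k, hk⟩ := exists_nat_gt (1 / p)
  have hpk : 1 < p * k := by rwa [div_lt_iff₀' hp] at hk
  have hs : Summable fun n : ℕ =>
      ((k.factorial : ℝ) / (a * b ^ k)) * (1 / (n : ℝ) ^ (p * k)) :=
    (Real.summable_one_div_nat_rpow.2 hpk).mul_left _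
  rw [← summable_nat_add_iff 1] at hs ⊢
  refine Summable.of_nonneg_of_le (fun n => (Real.exp_pos _).le) (fun n => ?_) hs
  have hn : (0 : ℝ) < ((n + 1 : ℕ) : ℝ) := by positivity
  generalize ((n + 1 : ℕ) : ℝ) = x at hn ⊢
  have hx : 0 < x ^ p := Real.rpow_pos_of_pos hn p
  have hfac : (0 : ℝ) < k.factorial := by positivity
  have h₁ : (b * x ^ p) ^ k / k.factorial ≤ Real.exp (b * x ^ p) :=
    Real.pow_div_factorial_le_exp _ (by positivity) k
  have h₂ : a * ((b * x ^ p) ^ k / k.factorial) ≤ Real.exp (a * Real.exp (b * x ^ p)) := by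
    have := Real.add_one_le_exp (a * Real.exp (b * x ^ p))
    have := mul_le_mul_of_nonneg_left h₁ ha.le
    linarith
  rw [Real.exp_neg, Real.rpow_mul hn.le, Real.rpow_natCast]
  calc (Real.exp (a * Real.exp (b * x ^ p)))⁻¹
      ≤ (a * ((b * x ^ p) ^ k / k.factorial))⁻¹ := inv_anti₀ (by positivity) h₂
    _ = _ := by rw [mul_pow]; field_simp

/-- Once `y ≥ 2 log (1 + ε⁻¹)`, half of the exponent `y` absorbs the factor `ε`. -/
theorem exp_half_le_mul_exp {ε y : ℝ} (hε : 0 < ε) (hy : 2 * Real.log (1 + ε⁻¹) ≤ y) :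
    Real.exp (y / 2) ≤ ε * Real.exp y := by
  have hpos : 0 < 1 + ε⁻¹ := by positivity
  have h₁ : 1 + ε⁻¹ ≤ Real.exp (y / 2) := by
    rw [← Real.log_le_iff_le_exp hpos]
    linarith
  have h₂ : 1 ≤ ε * Real.exp (y / 2) := by
    have := mul_le_mul_of_nonneg_left h₁ hε.le
    rw [mul_add, mul_inv_cancel₀ hε.ne'] at this
    linarith
  calc Real.exp (y / 2) ≤ (ε * Real.exp (y / 2)) * Real.exp (y / 2) :=
        le_mul_of_one_le_left (Real.exp_pos _).le h₂
    _ = ε * Real.exp y := by rw [mul_assoc, ← Real.exp_add, add_halves]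

/-- If `λ_n ≥ c e^{c n^p}` with `p > 0`, then
`∑_{n≥1} e^{-2ελ_n} ≤ C (log(1+ε⁻¹))^{1/p}` for all `ε ∈ (0,1]`. -/
theorem stmt_6 (p c : ℝ) (hp : 0 < p) (hc : 0 < c) (lam : ℕ → ℝ)
    (hlam : ∀ n : ℕ, 1 ≤ n → c * Real.exp (c * (n : ℝ) ^ p) ≤ lam n) :
    ∃ C : ℝ, 0 < C ∧ ∀ ε : ℝ, 0 < ε → ε ≤ 1 →
      ∑' n : ℕ, Real.exp (-2 * ε * lam (n + 1)) ≤
        C * Real.log (1 + ε⁻¹) ^ (1 / p) := by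
  set g : ℕ → ℝ := fun n => Real.exp (-(2 * c * Real.exp (c / 2 * ((n + 1 : ℕ) : ℝ) ^ p))) with hg
  have hgs : Summable g := (summable_nat_add_iff 1).2
    (summable_exp_neg_mul_exp_rpow (a := 2 * c) (b := c / 2) (by positivity) (by positivity) hp)
  have hg0 : ∀ n, 0 ≤ g n := fun n => (Real.exp_pos _).le
  have hG : 0 ≤ ∑' n, g n := tsum_nonneg hg0
  have hlog2 : 0 < Real.log 2 := Real.log_pos (by norm_num)
  have hD : 0 < Real.log 2 ^ (1 / p) := Real.rpow_pos_of_pos hlog2 _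
  refine ⟨(2 / c) ^ (1 / p) + (∑' n, g n) / Real.log 2 ^ (1 / p), by positivity, ?_⟩
  intro ε hε hε1
  set L := Real.log (1 + ε⁻¹) with hL
  have hL2 : Real.log 2 ≤ L := Real.log_le_log (by norm_num) (by
    have := (one_le_inv₀ hε).2 hε1
    linarith)
  have hL0 : 0 < L := hlog2.trans_le hL2
  set T := (2 / c * L) ^ (1 / p) with hT
  have hT0 : 0 ≤ T := by positivity
  set f : ℕ → ℝ := fun n => if n ∈ Finset.range ⌊T⌋₊ then 1 else 0 with hf
  have hf0 : ∀ n ∉ Finset.range ⌊T⌋₊, f n = 0 := fun n hn => if_neg hn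
  have hfs : Summable f := summable_of_ne_finset_zero hf0
  have hfsum : ∑' n, f n ≤ T := by
    rw [tsum_eq_sum hf0, Finset.sum_congr rfl fun n hn => if_pos hn]
    simpa using Nat.floor_le hT0
  have hle : ∀ n : ℕ, Real.exp (-2 * ε * lam (n + 1)) ≤ f n + g n := by
    intro n
    have hl := hlam (n + 1) (by omega)
    by_cases hn : n ∈ Finset.range ⌊T⌋₊
    · have hlpos : 0 < lam (n + 1) := lt_of_lt_of_le (by positivity) hl
      have h₁ : Real.exp (-2 * ε * lam (n + 1)) ≤ 1 := by
        rw [Real.exp_le_one_iff]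
        nlinarith [mul_pos hε hlpos]
      have h₂ : f n = 1 := if_pos hn
      linarith [hg0 n]
    · have hTn : T ≤ ((n + 1 : ℕ) : ℝ) := by
        have h₁ : ⌊T⌋₊ ≤ n := by simpa using hn
        exact ((Nat.floor_lt hT0).1 (by omega)).le
      have hpow : 2 / c * L ≤ ((n + 1 : ℕ) : ℝ) ^ p := by
        have h₁ := Real.rpow_le_rpow hT0 hTn hp.le
        rwa [hT, ← Real.rpow_mul (by positivity), one_div_mul_cancel hp.ne', Real.rpow_one] at h₁
      have hy : 2 * L ≤ c * ((n + 1 : ℕ) : ℝ) ^ p := by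
        calc 2 * L = c * (2 / c * L) := by field_simp
          _ ≤ _ := mul_le_mul_of_nonneg_left hpow hc.le
      have hexp := exp_half_le_mul_exp hε hy
      rw [hf0 n hn, zero_add, hg]
      refine Real.exp_le_exp.2 ?_
      rw [mul_div_right_comm] at hexp
      have h₁ := mul_le_mul_of_nonneg_left hl hε.le
      have h₂ := mul_le_mul_of_nonneg_left hexp hc.le
      nlinarith
  have hsum : Summable fun n : ℕ => Real.exp (-2 * ε * lam (n + 1)) :=
    Summable.of_nonneg_of_le (fun n => (Real.exp_pos _).le) hle (hfs.add hgs)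
  calc ∑' n : ℕ, Real.exp (-2 * ε * lam (n + 1))
      ≤ ∑' n, (f n + g n) := hsum.tsum_le_tsum hle (hfs.add hgs)
    _ = ∑' n, f n + ∑' n, g n := hfs.tsum_add hgs
    _ ≤ T + (∑' n, g n) / Real.log 2 ^ (1 / p) * L ^ (1 / p) := by
        refine add_le_add hfsum ?_
        rw [div_mul_eq_mul_div, le_div_iff₀ hD]
        exact mul_le_mul_of_nonneg_left
          (Real.rpow_le_rpow hlog2.le hL2 (by positivity)) hG
    _ = _ := by
        rw [hT, Real.mul_rpow (by positivity) hL0.le, add_mul]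
end

section
/- Let p > 0, c > 0 and let (λ_n)_{n≥1} be positive real numbers with λ_n ≥ c·exp(c n^p) for all n ≥ 1. Then there exists a constant C > 0 such that for every ε ∈ (0,1], ∑_{n=1}^∞ (1 − e^{−2ελ_n})/λ_n ≤ C ε (log(1 + ε^{−1}))^{1/p}. -/
lemma summable_exp_neg_mul_rpow {a p : ℝ} (ha : 0 < a) (hp : 0 < p) :
    Summable fun n : ℕ => Real.exp (-a * (n : ℝ) ^ p) := by
  have ho := ((isLittleO_exp_neg_mul_rpow_atTop ha (-2 / p)).comp_tendsto
    (tendsto_rpow_atTop hp)).comp_tendsto tendsto_natCast_atTop_atTop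
  refine summable_of_isBigO_nat (Real.summable_nat_rpow.2 (by norm_num : (-2 : ℝ) < -1))
    (ho.isBigO.congr_right fun n => ?_)
  simp only [Function.comp_apply]
  rw [← Real.rpow_mul (Nat.cast_nonneg n), mul_div_cancel₀ _ hp.ne']

lemma one_sub_exp_div_le {ε l : ℝ} (hl : 0 < l) :
    (1 - Real.exp (-2 * ε * l)) / l ≤ 2 * ε := by
  rw [div_le_iff₀ hl]
  linarith [Real.add_one_le_exp (-2 * ε * l)]

/-- Past the threshold `x ^ p ≥ (2 / c) log (1 + ε⁻¹)`, half of the exponential growth of `l`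
already yields a factor `ε`. -/
lemma one_sub_exp_div_le_of_log_le {p c ε l x : ℝ} (hc : 0 < c) (hε : 0 < ε)
    (hl : c * Real.exp (c * x ^ p) ≤ l) (hx : Real.log (1 + ε⁻¹) ≤ c / 2 * x ^ p) :
    (1 - Real.exp (-2 * ε * l)) / l ≤ ε / c * Real.exp (-(c / 2) * x ^ p) := by
  have hinv : ε⁻¹ ≤ Real.exp (c / 2 * x ^ p) := by
    have h := (Real.log_le_iff_le_exp (by positivity)).1 hx
    linarith
  have hsplit : Real.exp (c * x ^ p) = Real.exp (c / 2 * x ^ p) * Real.exp (c / 2 * x ^ p) := by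
    rw [← Real.exp_add]; ring_nf
  calc (1 - Real.exp (-2 * ε * l)) / l ≤ 1 / l := by
        have hl0 : 0 < l := lt_of_lt_of_le (by positivity) hl
        gcongr
        linarith [Real.exp_pos (-2 * ε * l)]
    _ ≤ 1 / (c * (ε⁻¹ * Real.exp (c / 2 * x ^ p))) := by
        refine one_div_le_one_div_of_le (by positivity) (le_trans ?_ hl)
        rw [hsplit]
        gcongr
    _ = ε / c * Real.exp (-(c / 2) * x ^ p) := by
        rw [neg_mul, Real.exp_neg]
        field_simp

/-- If `λ_n ≥ c e^{c n^p} > 0` with `p > 0`, then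
`∑_{n≥1} (1-e^{-2ελ_n})/λ_n ≤ C ε (log(1+ε⁻¹))^{1/p}` for all `ε ∈ (0,1]`. -/
theorem stmt_7 (p c : ℝ) (hp : 0 < p) (hc : 0 < c) (lam : ℕ → ℝ)
    (hpos : ∀ n : ℕ, 1 ≤ n → 0 < lam n)
    (hlam : ∀ n : ℕ, 1 ≤ n → c * Real.exp (c * (n : ℝ) ^ p) ≤ lam n) :
    ∃ C : ℝ, 0 < C ∧ ∀ ε : ℝ, 0 < ε → ε ≤ 1 →
      ∑' n : ℕ, (1 - Real.exp (-2 * ε * lam (n + 1))) / lam (n + 1) ≤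
        C * ε * Real.log (1 + ε⁻¹) ^ (1 / p) := by
  set g : ℕ → ℝ := fun n => Real.exp (-(c / 2) * ((n + 1 : ℕ) : ℝ) ^ p)
  have hgs : Summable g :=
    (summable_nat_add_iff 1).2 (summable_exp_neg_mul_rpow (half_pos hc) hp)
  have hS : 0 ≤ ∑' n, g n := tsum_nonneg fun n => (Real.exp_pos _).le
  have hlog2 : 0 < Real.log 2 := Real.log_pos (by norm_num)
  refine ⟨2 * (2 / c) ^ (1 / p) + (∑' n, g n) / c / Real.log 2 ^ (1 / p), by positivity,
    fun ε hε hε1 => ?_⟩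
  set L := Real.log (1 + ε⁻¹)
  have hL2 : Real.log 2 ≤ L := by
    refine Real.log_le_log (by norm_num) ?_
    linarith [(one_le_inv₀ hε).2 hε1]
  have hL0 : 0 < L := hlog2.trans_le hL2
  set N : ℝ := (2 / c * L) ^ (1 / p) with hN
  have hN0 : 0 ≤ N := by positivity
  have hhead : HasSum (fun n => if n ∈ Finset.range ⌊N⌋₊ then 2 * ε else 0) (⌊N⌋₊ * (2 * ε)) := by
    have h : HasSum (fun n => if n ∈ Finset.range ⌊N⌋₊ then 2 * ε else 0) _ :=
      hasSum_sum_of_ne_finset_zero fun n hn => if_neg hn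
    rw [Finset.sum_ite_mem] at h
    simpa using h
  have hmajor := hhead.add (hgs.hasSum.mul_left (ε / c))
  have hle (n : ℕ) : (1 - Real.exp (-2 * ε * lam (n + 1))) / lam (n + 1) ≤
      (if n ∈ Finset.range ⌊N⌋₊ then 2 * ε else 0) + ε / c * g n := by
    split_ifs with hn
    · exact (one_sub_exp_div_le (hpos _ n.succ_pos)).trans
        (le_add_of_nonneg_right (by positivity))
    · rw [zero_add]
      refine one_sub_exp_div_le_of_log_le hc hε (hlam _ n.succ_pos) ?_
      have hNn : N ≤ ((n + 1 : ℕ) : ℝ) := by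
        refine (Nat.lt_floor_add_one N).le.trans ?_
        rw [Finset.mem_range, not_lt] at hn
        exact_mod_cast Nat.succ_le_succ hn
      have hpow := Real.rpow_le_rpow hN0 hNn hp.le
      rw [hN, ← Real.rpow_mul (by positivity), one_div_mul_cancel hp.ne', Real.rpow_one] at hpow
      calc L = c / 2 * (2 / c * L) := by field_simp
        _ ≤ _ := by gcongr
  have hnonneg (n : ℕ) : 0 ≤ (1 - Real.exp (-2 * ε * lam (n + 1))) / lam (n + 1) := by
    have hl := hpos (n + 1) n.succ_pos
    refine div_nonneg (sub_nonneg.2 (Real.exp_le_one_iff.2 ?_)) hl.le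
    nlinarith [mul_pos hε hl]
  have hsum := Summable.of_nonneg_of_le hnonneg hle hmajor.summable
  have hratio : 1 ≤ L ^ (1 / p) / Real.log 2 ^ (1 / p) := by
    rw [one_le_div (by positivity)]
    gcongr
  calc ∑' n : ℕ, (1 - Real.exp (-2 * ε * lam (n + 1))) / lam (n + 1)
      ≤ ⌊N⌋₊ * (2 * ε) + ε / c * ∑' n, g n := hasSum_le hle hsum.hasSum hmajor
    _ ≤ N * (2 * ε) + ε / c * (∑' n, g n) * (L ^ (1 / p) / Real.log 2 ^ (1 / p)) := by
        refine add_le_add ?_ (le_mul_of_one_le_right (by positivity) hratio)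
        gcongr
        exact Nat.floor_le hN0
    _ = _ := by
        rw [hN, Real.mul_rpow (by positivity) hL0.le]
        ring
end

section
/- Let (λ_n)_{n≥1} be a nondecreasing sequence of real numbers with λ_1 > 0 and ∑_{n=1}^∞ 1/λ_n < ∞. Then there exists a constant k > 0 such that for every a ≥ 1 the infinite product ∏_{n=1}^∞ (λ_n + a)/√(λ_n² − λ₁²/2) converges and satisfies ∏_{n=1}^∞ (λ_n + a)/√(λ_n² − λ₁²/2) ≤ e^{k a}. -/
open Real

/-- Elementary bound for `x / √(x² - c²/2)`, with the denominator cleared. -/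
lemma sq_le_sqrt_sub_mul_add {c x : ℝ} (hc : 0 < c) (hcx : c ≤ x) :
    x ^ 2 ≤ Real.sqrt (x ^ 2 - c ^ 2 / 2) * (x + c) := by
  have hx : 0 < x := hc.trans_le hcx
  have hd : 0 ≤ x ^ 2 - c ^ 2 / 2 := by nlinarith
  refine (sq_le_sq₀ (by positivity) (by positivity)).1 ?_
  rw [mul_pow, Real.sq_sqrt hd]
  have h₁ : 0 ≤ c * x * (x - c) * (x + c) := by
    have := sub_nonneg.2 hcx
    positivity
  have h₂ : 0 ≤ c ^ 2 * (x - c) * (x + c) := by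
    have := sub_nonneg.2 hcx
    positivity
  have h₃ : 0 ≤ c * x ^ 3 := by positivity
  nlinarith

lemma one_le_add_div_sqrt {a c x : ℝ} (ha : 0 ≤ a) (hc : 0 < c) (hcx : c ≤ x) :
    1 ≤ (x + a) / Real.sqrt (x ^ 2 - c ^ 2 / 2) := by
  have hx : 0 < x := hc.trans_le hcx
  rw [one_le_div (Real.sqrt_pos.2 (by nlinarith))]
  refine (Real.sqrt_le_left (by positivity)).2 ?_
  nlinarith [mul_nonneg hx.le ha, sq_nonneg c, sq_nonneg a]

lemma log_add_div_sqrt_le {a c x : ℝ} (ha : 1 ≤ a) (hc : 0 < c) (hcx : c ≤ x) :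
    Real.log ((x + a) / Real.sqrt (x ^ 2 - c ^ 2 / 2)) ≤ (1 + c) * a * (1 / x) := by
  have hx : 0 < x := hc.trans_le hcx
  have hs : 0 < Real.sqrt (x ^ 2 - c ^ 2 / 2) := Real.sqrt_pos.2 (by nlinarith)
  have hle : (x + a) / Real.sqrt (x ^ 2 - c ^ 2 / 2) ≤ (a / x + 1) * (c / x + 1) := by
    rw [div_le_iff₀ hs]
    have h := mul_le_mul_of_nonneg_left (sq_le_sqrt_sub_mul_add hc hcx)
      (by positivity : 0 ≤ (x + a) / x ^ 2)
    calc x + a = (x + a) / x ^ 2 * x ^ 2 := by field_simp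
      _ ≤ _ := h
      _ = _ := by field_simp; ring
  rw [Real.log_le_iff_le_exp (by positivity)]
  calc _ ≤ _ := hle
    _ ≤ Real.exp (a / x) * Real.exp (c / x) := by
      gcongr <;> exact Real.add_one_le_exp _
    _ = Real.exp ((a + c) * (1 / x)) := by rw [← Real.exp_add]; ring_nf
    _ ≤ _ := by
      gcongr
      nlinarith

/-- For a nondecreasing sequence `λ_n` with `λ_1 > 0` (here indexed from `0`, with
`lam 0` playing the role of `λ₁`) and `∑ 1/λ_n < ∞`, there is `k > 0` such that
for all `a ≥ 1` the product `∏_n (λ_n + a)/√(λ_n² - λ₁²/2)` converges and is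
bounded by `e^{k a}`. -/
theorem stmt_8 (lam : ℕ → ℝ) (hmono : Monotone lam) (hpos : 0 < lam 0)
    (hsum : Summable fun n : ℕ => 1 / lam n) :
    ∃ k : ℝ, 0 < k ∧ ∀ a : ℝ, 1 ≤ a →
      Multipliable (fun n : ℕ => (lam n + a) / Real.sqrt (lam n ^ 2 - lam 0 ^ 2 / 2)) ∧
      ∏' n : ℕ, (lam n + a) / Real.sqrt (lam n ^ 2 - lam 0 ^ 2 / 2) ≤
        Real.exp (k * a) := by
  have hle (n : ℕ) : lam 0 ≤ lam n := hmono n.zero_le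
  have hlam (n : ℕ) : 0 < lam n := hpos.trans_le (hle n)
  have htsum : 0 < ∑' n, 1 / lam n :=
    hsum.tsum_pos (fun n => (one_div_pos.2 (hlam n)).le) 0 (one_div_pos.2 hpos)
  refine ⟨(1 + lam 0) * ∑' n, 1 / lam n, by positivity, fun a ha => ?_⟩
  have hone (n : ℕ) := one_le_add_div_sqrt (zero_le_one.trans ha) hpos (hle n)
  have hfac (n : ℕ) := one_pos.trans_le (hone n)
  have hlog (n : ℕ) := log_add_div_sqrt_le ha hpos (hle n)
  have hbound := hsum.mul_left ((1 + lam 0) * a)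
  have hslog := hbound.of_nonneg_of_le (fun n => Real.log_nonneg (hone n)) hlog
  refine ⟨Real.multipliable_of_summable_log hfac hslog, ?_⟩
  rw [← Real.rexp_tsum_eq_tprod hfac hslog, Real.exp_le_exp]
  calc _ ≤ _ := hslog.tsum_le_tsum hlog hbound
    _ = _ := by rw [tsum_mul_left]; ring
end

section
/- Let (λ_n)_{n≥1} be positive reals and let μ₀ be the product probability measure on ℝ^ℕ whose n-th factor is the centered Gaussian measure on ℝ with variance 1/λ_n. For x ∈ ℝ^ℕ write ‖x‖² = ∑_{n=1}^∞ x_n² ∈ [0,∞]. Then for every r > 0, every R > 0 and every m ≥ 1, μ₀({x ∈ ℝ^ℕ : ‖x‖ < r}) ≤ e^{R r²/2} · ∏_{n=1}^{m} √(λ_n/(λ_n + R)). -/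
open MeasureTheory ProbabilityTheory

lemma integral_exp_neg_mul_sq_gaussianReal {l R : ℝ} (hl : 0 < l) (hR : 0 < R) :
    ∫ x, Real.exp (-(R / 2) * x ^ 2) ∂gaussianReal 0 (1 / l).toNNReal =
      Real.sqrt (l / (l + R)) := by
  have hv : (1 / l).toNNReal ≠ 0 := by
    simpa using hl
  have hv' : (((1 / l).toNNReal : NNReal) : ℝ) = 1 / l :=
    Real.coe_toNNReal _ (by positivity)
  have hpdf (x : ℝ) : gaussianPDFReal 0 (1 / l).toNNReal x • Real.exp (-(R / 2) * x ^ 2) =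
      (Real.sqrt (2 * Real.pi * (1 / l)))⁻¹ * Real.exp (-((l + R) / 2) * x ^ 2) := by
    rw [gaussianPDFReal, hv', smul_eq_mul, mul_assoc, ← Real.exp_add]
    congr 2
    field_simp
    ring
  rw [integral_gaussianReal_eq_integral_smul hv]
  simp_rw [hpdf]
  rw [integral_const_mul, integral_gaussian, ← Real.sqrt_inv, ← Real.sqrt_mul (by positivity)]
  congr 1
  field_simp

lemma integrable_exp_neg_mul_sq_of_isFiniteMeasure {μ : Measure ℝ} [IsFiniteMeasure μ]
    {R : ℝ} (hR : 0 ≤ R) :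
    Integrable (fun x => Real.exp (-(R / 2) * x ^ 2)) μ := by
  refine Integrable.of_bound (by fun_prop) 1 (ae_of_all _ fun x => ?_)
  rw [Real.norm_eq_abs, Real.abs_exp, Real.exp_le_one_iff]
  nlinarith [mul_nonneg hR (sq_nonneg x)]

lemma pi_sum_sq_lt_le {ι : Type*} [Fintype ι] (μ : ι → Measure ℝ)
    [∀ i, IsProbabilityMeasure (μ i)] {R : ℝ} (hR : 0 ≤ R) (r : ℝ) :
    Measure.pi μ {y | ∑ i, y i ^ 2 < r ^ 2} ≤
      ENNReal.ofReal (Real.exp (R * r ^ 2 / 2) *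
        ∏ i, ∫ x, Real.exp (-(R / 2) * x ^ 2) ∂μ i) := by
  have hint : Integrable (fun y : ι → ℝ => ∏ i, Real.exp (-(R / 2) * y i ^ 2))
      (Measure.pi μ) :=
    Integrable.fintype_prod fun i => integrable_exp_neg_mul_sq_of_isFiniteMeasure (μ := μ i) hR
  have hmarkov := mul_meas_ge_le_integral_of_nonneg
    (ae_of_all _ fun y : ι → ℝ =>
      Finset.prod_nonneg fun i _ => (Real.exp_pos (-(R / 2) * y i ^ 2)).le)
    hint (Real.exp (-(R * r ^ 2 / 2)))
  rw [integral_fintype_prod_eq_prod (f := fun _ x => Real.exp (-(R / 2) * x ^ 2)),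
    Real.exp_neg, inv_mul_le_iff₀ (Real.exp_pos _)] at hmarkov
  refine (measure_mono fun y hy => ?_).trans
    (ENNReal.le_ofReal_iff_toReal_le (measure_ne_top _ _) ?_ |>.2 hmarkov)
  · simp only [Set.mem_ofPred_eq] at hy ⊢
    rw [← Real.exp_sum, ← Finset.mul_sum, ← Real.exp_neg, Real.exp_le_exp]
    nlinarith
  · exact mul_nonneg (Real.exp_pos _).le
      (Finset.prod_nonneg fun i _ => integral_nonneg fun x => (Real.exp_pos _).le)

lemma sum_sq_lt_of_tsum_lt {x : ℕ → ℝ} {c : ℝ} (m : ℕ)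
    (hx : ∑' n, ENNReal.ofReal (x n ^ 2) < ENNReal.ofReal c) :
    ∑ i : Fin m, x i ^ 2 < c := by
  have h := (ENNReal.sum_le_tsum (Finset.range m)).trans_lt hx
  rw [← ENNReal.ofReal_sum_of_nonneg fun i _ => sq_nonneg (x i)] at h
  rw [Fin.sum_univ_eq_sum_range fun n => x n ^ 2]
  exact (ENNReal.ofReal_lt_ofReal_iff_of_nonneg
    (Finset.sum_nonneg fun i _ => sq_nonneg (x i))).1 h

/-- For the product Gaussian measure `μ₀` on `ℝ^ℕ` with variances `1/λ_n`
(here indexed from `0`), characterized by its finite-dimensional marginals: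
`μ₀(‖x‖ < r) ≤ e^{R r²/2} ∏_{n<m} √(λ_n/(λ_n+R))` for all `r, R > 0`, `m ≥ 1`. -/
theorem stmt_10 (lam : ℕ → ℝ) (hlam : ∀ n : ℕ, 0 < lam n)
    (μ₀ : Measure (ℕ → ℝ)) [IsProbabilityMeasure μ₀]
    (hμ₀ : ∀ m : ℕ, μ₀.map (fun x (i : Fin m) => x (i : ℕ)) =
      Measure.pi fun i : Fin m => gaussianReal 0 (1 / lam (i : ℕ)).toNNReal)
    (r R : ℝ) (hr : 0 < r) (hR : 0 < R) (m : ℕ) (hm : 1 ≤ m) :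
    μ₀ {x : ℕ → ℝ | (∑' n : ℕ, ENNReal.ofReal (x n ^ 2)) < ENNReal.ofReal (r ^ 2)} ≤
      ENNReal.ofReal (Real.exp (R * r ^ 2 / 2) *
        ∏ n ∈ Finset.range m, Real.sqrt (lam n / (lam n + R))) := by
  have hmeas : MeasurableSet {y : Fin m → ℝ | ∑ i, y i ^ 2 < r ^ 2} :=
    measurableSet_lt (by fun_prop) measurable_const
  have hbound := pi_sum_sq_lt_le
    (fun i : Fin m => gaussianReal 0 (1 / lam (i : ℕ)).toNNReal) hR.le r
  simp_rw [integral_exp_neg_mul_sq_gaussianReal (hlam _) hR] at hbound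
  rw [← hμ₀ m, Measure.map_apply (by fun_prop) hmeas,
    Fin.prod_univ_eq_prod_range fun n => Real.sqrt (lam n / (lam n + R))] at hbound
  exact (measure_mono fun x hx => sum_sq_lt_of_tsum_lt m hx).trans hbound
end

section
/- Let p > 1, k₂ > 0 and let (λ_n)_{n≥1} be positive reals with λ_n ≤ k₂ n^p for all n ≥ 1. Let μ₀ be the product probability measure on ℝ^ℕ whose n-th factor is the centered Gaussian measure on ℝ with variance 1/λ_n, and for x ∈ ℝ^ℕ write ‖x‖² = ∑_{n=1}^∞ x_n² ∈ [0,∞]. Then there exist constants C, c > 0 such that for every r > 0, μ₀({x ∈ ℝ^ℕ : ‖x‖ < r}) ≤ C · exp(−c r^{−2/(p−1)}). -/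
open MeasureTheory ProbabilityTheory

/-- The Laplace transform of the square of a centered Gaussian variable. -/
theorem integral_exp_neg_mul_sq_gaussianReal_s11 {v : NNReal} (hv : v ≠ 0) {t : ℝ} (ht : 0 ≤ t) :
    ∫ x, Real.exp (-t * x ^ 2) ∂(gaussianReal 0 v) = (√(1 + 2 * t * v))⁻¹ := by
  have hv' : (0 : ℝ) < v := NNReal.coe_pos.2 (pos_iff_ne_zero.2 hv)
  rw [integral_gaussianReal_eq_integral_smul hv]
  have h (x : ℝ) : gaussianPDFReal 0 v x • Real.exp (-t * x ^ 2) =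
      (√(2 * Real.pi * v))⁻¹ * Real.exp (-(t + 1 / (2 * v)) * x ^ 2) := by
    rw [gaussianPDFReal, smul_eq_mul, mul_assoc, ← Real.exp_add]
    congr 2
    field_simp
    ring
  simp_rw [h]
  rw [integral_const_mul, integral_gaussian, ← Real.sqrt_inv, ← Real.sqrt_inv,
    ← Real.sqrt_mul (by positivity)]
  congr 1
  have := Real.pi_pos
  field_simp
  ring

/-- Small ball estimate for a Gaussian vector with independent coordinates of variance at
least `1 / L`. -/
theorem pi_gaussianReal_sum_sq_le {m : ℕ} {v : Fin m → NNReal} {L : ℝ} (hL : 0 < L)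
    (hv : ∀ i, 1 / L ≤ v i) (a : ℝ) :
    (Measure.pi fun i => gaussianReal 0 (v i)).real {y | ∑ i, y i ^ 2 ≤ a} ≤
      Real.exp (L / 2 * a - m * (Real.log 2 / 2)) := by
  have h_int : Integrable (fun y : Fin m → ℝ => Real.exp (-(L / 2) * ∑ i, y i ^ 2))
      (Measure.pi fun i => gaussianReal 0 (v i)) := by
    refine Integrable.of_bound (C := 1) (Measurable.aestronglyMeasurable (by fun_prop))
      (ae_of_all _ fun y => ?_)
    rw [Real.norm_eq_abs, Real.abs_exp, Real.exp_le_one_iff]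
    have : 0 ≤ L / 2 * ∑ i, y i ^ 2 := by positivity
    linarith
  refine (measure_le_le_exp_mul_mgf a (t := -(L / 2)) (by linarith) h_int).trans ?_
  have hmgf : mgf (fun y : Fin m → ℝ => ∑ i, y i ^ 2)
      (Measure.pi fun i => gaussianReal 0 (v i)) (-(L / 2)) ≤ Real.exp (-(Real.log 2 / 2)) ^ m := by
    simp_rw [mgf, Finset.mul_sum, Real.exp_sum]
    rw [integral_fintype_prod_eq_prod (fun (_ : Fin m) (x : ℝ) => Real.exp (-(L / 2) * x ^ 2))]
    calc _ ≤ ∏ _i : Fin m, Real.exp (-(Real.log 2 / 2)) := by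
          refine Finset.prod_le_prod (fun i _ => integral_nonneg fun x => (Real.exp_pos _).le)
            fun i _ => ?_
          have hvi : (0 : ℝ) < v i := (by positivity : 0 < 1 / L).trans_le (hv i)
          rw [integral_exp_neg_mul_sq_gaussianReal_s11 (NNReal.coe_pos.1 hvi).ne' (by positivity),
            Real.exp_neg, Real.exp_half, Real.exp_log two_pos]
          gcongr
          have := (div_le_iff₀ hL).1 (hv i)
          linarith
      _ = _ := by simp
  calc _ ≤ Real.exp (-(-(L / 2)) * a) * Real.exp (-(Real.log 2 / 2)) ^ m := by gcongr
    _ = _ := by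
      rw [← Real.exp_nat_mul, ← Real.exp_add]
      ring_nf

/-- If `λ_n ≤ k₂ n^p` (`p > 1`; here indexed from `0`, so `lam n` plays the role of
`λ_{n+1}`) and `μ₀` is the product Gaussian measure on `ℝ^ℕ` with variances `1/λ_n`,
then `μ₀(‖x‖ < r) ≤ C exp(-c r^{-2/(p-1)})` for all `r > 0`. -/
theorem stmt_11 (p k₂ : ℝ) (hp : 1 < p) (hk₂ : 0 < k₂)
    (lam : ℕ → ℝ) (hlam : ∀ n : ℕ, 0 < lam n)
    (hub : ∀ n : ℕ, lam n ≤ k₂ * ((n : ℝ) + 1) ^ p)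
    (μ₀ : Measure (ℕ → ℝ)) [IsProbabilityMeasure μ₀]
    (hμ₀ : ∀ m : ℕ, μ₀.map (fun x (i : Fin m) => x (i : ℕ)) =
      Measure.pi fun i : Fin m => gaussianReal 0 (1 / lam (i : ℕ)).toNNReal) :
    ∃ C c : ℝ, 0 < C ∧ 0 < c ∧ ∀ r : ℝ, 0 < r →
      μ₀ {x : ℕ → ℝ | (∑' n : ℕ, ENNReal.ofReal (x n ^ 2)) < ENNReal.ofReal (r ^ 2)} ≤
        ENNReal.ofReal (C * Real.exp (-c * r ^ (-2 / (p - 1)))) := by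
  have hp' : 0 < p - 1 := sub_pos.2 hp
  have hlog : 0 < Real.log 2 := Real.log_pos one_lt_two
  set A : ℝ := (Real.log 2 / (2 * k₂)) ^ (1 / (p - 1)) with hA
  have hA0 : 0 < A := by positivity
  refine ⟨Real.exp (Real.log 2 / 4), A * (Real.log 2 / 4), by positivity, by positivity,
    fun r hr => ?_⟩
  rw [← Real.exp_add]
  set s : ℝ := r ^ (-2 / (p - 1)) with hs
  have hs0 : 0 < s := by positivity
  set m : ℕ := ⌊A * s⌋₊ with hm
  have hm_lt : A * s < m + 1 := Nat.lt_floor_add_one _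
  rcases Nat.eq_zero_or_pos m with hm0 | hm0
  · refine prob_le_one.trans (ENNReal.one_le_ofReal.2 (Real.one_le_exp ?_))
    rw [hm0] at hm_lt
    push_cast at hm_lt
    nlinarith
  have hmR : (0 : ℝ) < m := Nat.cast_pos.2 hm0
  set L : ℝ := k₂ * (m : ℝ) ^ p with hLdef
  have hL : 0 < L := by positivity
  have hLr : L * r ^ 2 ≤ m * (Real.log 2 / 2) := by
    have h1 : (m : ℝ) ^ (p - 1) ≤ (A * s) ^ (p - 1) :=
      Real.rpow_le_rpow hmR.le (Nat.floor_le (by positivity)) hp'.le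
    have h2 : (A * s) ^ (p - 1) = Real.log 2 / (2 * k₂) * (r ^ 2)⁻¹ := by
      rw [Real.mul_rpow hA0.le hs0.le, hA, hs, ← Real.rpow_mul (by positivity),
        ← Real.rpow_mul hr.le, div_mul_cancel₀ _ hp'.ne', div_mul_cancel₀ _ hp'.ne',
        Real.rpow_one, Real.rpow_neg hr.le, Real.rpow_two]
    have h3 : (m : ℝ) ^ p = m ^ (p - 1) * m := by
      rw [← Real.rpow_add_one hmR.ne', sub_add_cancel]
    calc L * r ^ 2 = m ^ (p - 1) * (k₂ * m * r ^ 2) := by rw [hLdef, h3]; ring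
      _ ≤ Real.log 2 / (2 * k₂) * (r ^ 2)⁻¹ * (k₂ * m * r ^ 2) := by
        rw [← h2]; gcongr
      _ = _ := by field_simp
  have hv (i : Fin m) : 1 / L ≤ ((1 / lam i).toNNReal : ℝ) := by
    rw [Real.coe_toNNReal _ (one_div_nonneg.2 (hlam i).le)]
    refine one_div_le_one_div_of_le (hlam i) ((hub i).trans ?_)
    have : ((i : ℕ) : ℝ) + 1 ≤ m := by exact_mod_cast i.2
    rw [hLdef]
    gcongr
  have hmeas : Measurable fun (x : ℕ → ℝ) (i : Fin m) => x (i : ℕ) := by fun_prop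
  have hset : MeasurableSet {y : Fin m → ℝ | ∑ i, y i ^ 2 ≤ r ^ 2} :=
    measurableSet_le (by fun_prop) measurable_const
  calc _ ≤ μ₀ ((fun x (i : Fin m) => x (i : ℕ)) ⁻¹' {y | ∑ i, y i ^ 2 ≤ r ^ 2}) := by
        refine measure_mono fun x hx => ?_
        have h := (ENNReal.sum_le_tsum (Finset.range m)).trans (le_of_lt hx)
        rw [← ENNReal.ofReal_sum_of_nonneg fun _ _ => sq_nonneg _,
          ENNReal.ofReal_le_ofReal_iff (sq_nonneg r), Finset.sum_range] at h
        exact h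
    _ = (Measure.pi fun i : Fin m => gaussianReal 0 (1 / lam (i : ℕ)).toNNReal)
          {y | ∑ i, y i ^ 2 ≤ r ^ 2} := by
        rw [← hμ₀, Measure.map_apply hmeas hset]
    _ ≤ _ := by
        rw [← ofReal_measureReal]
        refine ENNReal.ofReal_le_ofReal ((pi_gaussianReal_sum_sq_le hL hv _).trans
          (Real.exp_le_exp.2 ?_))
        nlinarith
end

section
/- Let a, b > 0 and p > 0. Then there exists a constant C > 0 such that for every t ≥ 4, inf_{ε ∈ (0,1)} ( t^{−1} e^{a/ε} + b ε (log(1 + ε^{−1}))^{1/p} ) ≤ C (log t)^{−1} (log log t)^{1/p}. -/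
open Real

/-- For `a, b > 0` and `p > 0`, there is `C > 0` with
`inf_{ε ∈ (0,1)} (t⁻¹ e^{a/ε} + b ε (log(1+ε⁻¹))^{1/p}) ≤ C (log t)⁻¹ (log log t)^{1/p}`
for all `t ≥ 4`. -/
theorem stmt_14 (a b p : ℝ) (ha : 0 < a) (hb : 0 < b) (hp : 0 < p) :
    ∃ C : ℝ, 0 < C ∧ ∀ t : ℝ, 4 ≤ t →
      ⨅ ε : Set.Ioo (0 : ℝ) 1,
          (t⁻¹ * Real.exp (a / (ε : ℝ)) +
            b * (ε : ℝ) * Real.log (1 + (ε : ℝ)⁻¹) ^ (1 / p)) ≤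
        C * (Real.log t)⁻¹ * Real.log (Real.log t) ^ (1 / p) := by
  have hlog4 : 1 < Real.log 4 := by
    rw [Real.lt_log_iff_exp_lt (by norm_num)]
    linarith [Real.exp_one_lt_d9]
  set q := 1 / p with hq
  have hq0 : 0 < q := by positivity
  set l := Real.log (Real.log 4) with hl
  have hl0 : 0 < l := Real.log_pos hlog4
  set M := Real.log (2 + 1 / (2 * a)) with hM
  have hM0 : 0 < M := Real.log_pos (by have : 0 < 1 / (2 * a) := by positivity
                                       linarith)
  set K := 1 + M / l with hK
  have hK0 : 0 < K := by positivity
  refine ⟨2 * Real.exp a * (l ^ q)⁻¹ + b * (2 * a) * K ^ q, by positivity, fun t ht => ?_⟩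
  have ht0 : 0 < t := by linarith
  set L := Real.log t with hL
  have hL4 : Real.log 4 ≤ L := Real.log_le_log (by norm_num) ht
  have hL1 : 1 < L := by linarith
  have hL0 : 0 < L := by linarith
  have hlL : l ≤ Real.log L := Real.log_le_log (by linarith) hL4
  have hlogL : 0 < Real.log L := by linarith
  -- The choice `ε = 2a / (2a + log t)` always lies in `(0, 1)` and gives `a / ε = a + log t / 2`.
  have hε : 2 * a / (2 * a + L) ∈ Set.Ioo (0 : ℝ) 1 :=
    ⟨by positivity, by rw [div_lt_one (by positivity)]; linarith⟩
  have hbdd : BddBelow (Set.range fun ε : Set.Ioo (0 : ℝ) 1 =>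
      t⁻¹ * Real.exp (a / (ε : ℝ)) + b * (ε : ℝ) * Real.log (1 + (ε : ℝ)⁻¹) ^ q) := by
    refine ⟨0, ?_⟩
    rintro _ ⟨⟨ε, h0, h1⟩, rfl⟩
    have : 0 ≤ Real.log (1 + ε⁻¹) := Real.log_nonneg (by
      have := inv_pos.mpr h0
      linarith)
    positivity
  refine (ciInf_le hbdd ⟨_, hε⟩).trans ?_
  have hexp : t⁻¹ * Real.exp (a / (2 * a / (2 * a + L))) ≤
      2 * Real.exp a * (l ^ q)⁻¹ * L⁻¹ * Real.log L ^ q := by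
    have h1 : t⁻¹ * Real.exp (a / (2 * a / (2 * a + L))) =
        Real.exp a * (Real.exp (L / 2))⁻¹ := by
      rw [← Real.exp_log ht0, ← hL, ← Real.exp_neg, ← Real.exp_neg, ← Real.exp_add,
        ← Real.exp_add]
      congr 1
      field_simp
      ring
    have h2 : (Real.exp (L / 2))⁻¹ ≤ 2 * L⁻¹ := by
      rw [show 2 * L⁻¹ = (L / 2)⁻¹ by field_simp]
      exact inv_anti₀ (by positivity) (by linarith [Real.add_one_le_exp (L / 2)])
    have h3 : 1 ≤ (l ^ q)⁻¹ * Real.log L ^ q := by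
      rw [inv_mul_eq_div, one_le_div (by positivity)]
      exact Real.rpow_le_rpow hl0.le hlL hq0.le
    calc _ = Real.exp a * (Real.exp (L / 2))⁻¹ := h1
      _ ≤ Real.exp a * (2 * L⁻¹) := by gcongr
      _ ≤ Real.exp a * (2 * L⁻¹) * ((l ^ q)⁻¹ * Real.log L ^ q) :=
        le_mul_of_one_le_right (by positivity) h3
      _ = _ := by ring
  have hlog : Real.log (1 + (2 * a / (2 * a + L))⁻¹) ≤ K * Real.log L := by
    calc Real.log (1 + (2 * a / (2 * a + L))⁻¹) ≤ Real.log ((2 + 1 / (2 * a)) * L) := by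
          apply Real.log_le_log (by positivity)
          have : (2 * a / (2 * a + L))⁻¹ = 1 + 1 / (2 * a) * L := by field_simp
          rw [this]
          linarith
      _ = M + Real.log L := Real.log_mul (by positivity) hL0.ne'
      _ ≤ M / l * Real.log L + Real.log L := by
          gcongr
          rw [div_mul_eq_mul_div, le_div_iff₀ hl0]
          gcongr
      _ = _ := by ring
  have hmain : b * (2 * a / (2 * a + L)) * Real.log (1 + (2 * a / (2 * a + L))⁻¹) ^ q ≤
      b * (2 * a) * K ^ q * L⁻¹ * Real.log L ^ q := by
    have h0 : 0 ≤ Real.log (1 + (2 * a / (2 * a + L))⁻¹) := Real.log_nonneg (by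
      have := inv_pos.mpr hε.1
      linarith)
    calc _ ≤ b * (2 * a / L) * (K * Real.log L) ^ q := by
          gcongr
          linarith
      _ = _ := by rw [Real.mul_rpow hK0.le hlogL.le]; ring
  calc _ ≤ _ := add_le_add hexp hmain
    _ = _ := by ring
end
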